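/- Let P and Q be probability measures on a measurable space. Then the Kullback–Leibler divergence D(P‖Q), with values in [0, ∞], equals the supremum, over all finite measurable partitions {A_1, …, A_J} of the space, of the discrete Kullback–Leibler divergence ∑_{j=1}^{J} P(A_j) log(P(A_j)/Q(A_j)) between the induced distributions (P(A_1),…,P(A_J)) and (Q(A_1),…,Q(A_J)), computed with the conventions 0·log(0/q) = 0 and p·log(p/0) = +∞ for p > 0. -/

import Mathlib

open MeasureTheory
open scoped ENNReal Classical

/-- The Kullback–Leibler divergence `D(P‖Q) ∈ [0,∞]`: it equals
`∫ log (dP/dQ) dP` when `P ≪ Q` and the log-likelihood ratio is `P`-integrable,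
and `+∞` otherwise. -/
noncomputable def klDiv {α : Type*} [MeasurableSpace α] (P Q : Measure α) : ℝ≥0∞ :=
  if P ≪ Q ∧ Integrable (llr P Q) P then ENNReal.ofReal (∫ x, llr P Q x ∂P) else ⊤

/-- The discrete Kullback–Leibler divergence between the distributions induced by
`P` and `Q` on a finite measurable partition `A`, with the conventions
`0·log(0/q) = 0` and `p·log(p/0) = +∞` for `p > 0`. -/
noncomputable def discreteKL {α : Type*} [MeasurableSpace α] (P Q : Measure α)
    {J : ℕ} (A : Fin J → Set α) : ℝ≥0∞ :=
  if ∃ j, P (A j) ≠ 0 ∧ Q (A j) = 0 then ⊤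
  else ENNReal.ofReal
    (∑ j, (P (A j)).toReal * Real.log ((P (A j)).toReal / (Q (A j)).toReal))

section Auxiliary

variable {α : Type*} [MeasurableSpace α]

lemma klDiv_eq_informationTheory_klDiv (P Q : Measure α) [IsProbabilityMeasure P]
    [IsProbabilityMeasure Q] : klDiv P Q = InformationTheory.klDiv P Q := by
  simp [klDiv, InformationTheory.klDiv_def]

lemma toReal_rnDeriv_singleton {β : Type*} [MeasurableSpace β] [MeasurableSingletonClass β]
    {μ ν : Measure β} [IsFiniteMeasure μ] [IsFiniteMeasure ν] (h : μ ≪ ν) {b : β}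
    (hb : ν {b} ≠ 0) : (μ.rnDeriv ν b).toReal = μ.real {b} / ν.real {b} := by
  have := Measure.setLIntegral_rnDeriv h {b}
  rw [lintegral_singleton] at this
  rw [measureReal_def, measureReal_def, ← this, ENNReal.toReal_mul, mul_div_assoc, div_self, mul_one]
  simp [ENNReal.toReal_eq_zero_iff, hb]

lemma klDiv_fintype_of_ac {β : Type*} [Fintype β] [MeasurableSpace β]
    [MeasurableSingletonClass β] {μ ν : Measure β} [IsFiniteMeasure μ] [IsFiniteMeasure ν]
    (h : μ ≪ ν) :
    InformationTheory.klDiv μ ν =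
      ∑ b, ENNReal.ofReal (InformationTheory.klFun (μ.real {b} / ν.real {b})) * ν {b} := by
  rw [InformationTheory.klDiv_eq_lintegral_klFun_of_ac h, lintegral_fintype]
  refine Finset.sum_congr rfl fun b _ ↦ ?_
  by_cases hb : ν {b} = 0
  · simp [hb]
  · rw [toReal_rnDeriv_singleton h hb]

/-- The discrete divergence along the fibres of `g` is the divergence of the laws of `g`. -/
lemma discreteKL_preimage {J : ℕ} (P Q : Measure α) [IsProbabilityMeasure P]
    [IsProbabilityMeasure Q] {g : α → Fin J} (hg : Measurable g) :
    discreteKL P Q (fun j ↦ g ⁻¹' {j}) = InformationTheory.klDiv (P.map g) (Q.map g) := by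
  have := Measure.isProbabilityMeasure_map (μ := P) hg.aemeasurable
  have := Measure.isProbabilityMeasure_map (μ := Q) hg.aemeasurable
  simp only [discreteKL, ← Measure.map_apply hg (measurableSet_singleton _)]
  generalize P.map g = μ at *
  generalize Q.map g = ν at *
  split_ifs with h
  · obtain ⟨j, hμ, hν⟩ := h
    exact (InformationTheory.klDiv_of_not_ac fun hac ↦ hμ (hac hν)).symm
  push Not at h
  have hac : μ ≪ ν := by
    intro s hs
    rw [← Set.biUnion_of_singleton s, measure_biUnion_null_iff s.to_countable]
    intro j hj
    by_contra hμ
    exact h j hμ (measure_mono_null (Set.singleton_subset_iff.2 hj) hs)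
  rw [klDiv_fintype_of_ac hac]
  have hsum (ρ : Measure (Fin J)) [IsProbabilityMeasure ρ] : ∑ j, ρ.real {j} = 1 := by
    simp
  have hterm (j : Fin J) : (μ {j}).toReal * Real.log ((μ {j}).toReal / (ν {j}).toReal) =
      InformationTheory.klFun (μ.real {j} / ν.real {j}) * ν.real {j} + μ.real {j} - ν.real {j} := by
    simp only [InformationTheory.klFun, ← measureReal_def]
    by_cases hj : ν {j} = 0
    · simp [measureReal_def, hj, hac hj]
    · have : ν.real {j} ≠ 0 := by simpa [measureReal_def, ENNReal.toReal_eq_zero_iff] using hj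
      field_simp
      ring
  simp_rw [hterm, Finset.sum_sub_distrib, Finset.sum_add_distrib, hsum, add_sub_cancel_right]
  have hnn (j : Fin J) : 0 ≤ InformationTheory.klFun (μ.real {j} / ν.real {j}) :=
    InformationTheory.klFun_nonneg (by positivity)
  rw [ENNReal.ofReal_sum_of_nonneg fun j _ ↦ mul_nonneg (hnn j) measureReal_nonneg]
  simp [ENNReal.ofReal_mul (hnn _)]

/-- The ratio `P s / Q s` lies between any bounds for the density `dP/dQ` on `s`. -/
lemma measureReal_div_mem_Icc {P Q : Measure α} [IsFiniteMeasure P]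
    [IsFiniteMeasure Q] (h : P ≪ Q) {s : Set α} (hs : MeasurableSet s) (h0 : Q s ≠ 0) {a b : ℝ}
    (hab : ∀ x ∈ s, (P.rnDeriv Q x).toReal ∈ Set.Icc a b) :
    P.real s / Q.real s ∈ Set.Icc a b := by
  have hpos : 0 < Q.real s := ENNReal.toReal_pos h0 (measure_ne_top _ _)
  rw [Set.mem_Icc, le_div_iff₀ hpos, div_le_iff₀ hpos, ← Measure.setIntegral_toReal_rnDeriv h s]
  have hint : IntegrableOn (fun x ↦ (P.rnDeriv Q x).toReal) s Q :=
    Measure.integrable_toReal_rnDeriv.integrableOn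
  constructor
  · calc a * Q.real s = ∫ _ in s, a ∂Q := by simp [mul_comm]
      _ ≤ _ := setIntegral_mono_on (by simp) hint hs fun x hx ↦ (hab x hx).1
  · calc _ ≤ ∫ _ in s, b ∂Q := setIntegral_mono_on hint (by simp) hs fun x hx ↦ (hab x hx).2
      _ = _ := by simp [mul_comm]

/-- The index of the cell of the grid of mesh `1 / n` containing `t`, the last cell collecting all
`t ≥ n`. -/
noncomputable def gridIndex (n : ℕ) (t : ℝ) : Fin (n * n + 1) :=
  ⟨min ⌊n * t⌋₊ (n * n), by omega⟩

lemma measurable_gridIndex (n : ℕ) : Measurable (gridIndex n) := by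
  refine measurable_to_countable' fun j ↦ ?_
  have : gridIndex n ⁻¹' {j} = (fun t : ℝ ↦ min ⌊n * t⌋₊ (n * n)) ⁻¹' {(j : ℕ)} := by
    ext t
    simp [gridIndex, Fin.ext_iff]
  rw [this]
  have : Measurable fun t : ℝ ↦ min ⌊n * t⌋₊ (n * n) := by fun_prop
  exact this (measurableSet_singleton _)

lemma mem_Icc_of_gridIndex_eq {n : ℕ} {s t : ℝ} (hs : 0 ≤ s) (ht : 0 ≤ t) (htn : t < n)
    (h : gridIndex n s = gridIndex n t) : s ∈ Set.Icc (t - 1 / n) (t + 1 / n) := by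
  have hn : (0 : ℝ) < n := ht.trans_lt htn
  have hlt : ⌊n * t⌋₊ < n * n := by
    rw [Nat.floor_lt (by positivity)]
    push_cast
    gcongr
  have heq : ⌊n * s⌋₊ = ⌊n * t⌋₊ := by
    simp only [gridIndex, Fin.mk.injEq] at h
    omega
  have h1 := Nat.floor_le (mul_nonneg hn.le hs)
  have h2 := Nat.lt_floor_add_one (n * s)
  have h3 := Nat.floor_le (mul_nonneg hn.le ht)
  have h4 := Nat.lt_floor_add_one (n * t)
  rw [heq] at h1 h2
  constructor
  · have : n * (t - 1 / n) ≤ n * s := by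
      rw [mul_sub, mul_one_div_cancel hn.ne']; linarith
    exact le_of_mul_le_mul_left this hn
  · have : n * s ≤ n * (t + 1 / n) := by
      rw [mul_add, mul_one_div_cancel hn.ne']; linarith
    exact le_of_mul_le_mul_left this hn

open Filter Topology in
lemma klDiv_le_liminf_map_gridIndex {P Q : Measure α} [IsFiniteMeasure P]
    [IsFiniteMeasure Q] (h : P ≪ Q) :
    InformationTheory.klDiv P Q ≤ liminf (fun n ↦ InformationTheory.klDiv
      (P.map fun x ↦ gridIndex n (P.rnDeriv Q x).toReal)
      (Q.map fun x ↦ gridIndex n (P.rnDeriv Q x).toReal)) atTop := by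
  set f : α → ℝ := fun x ↦ (P.rnDeriv Q x).toReal
  have hfm : Measurable f := (Measure.measurable_rnDeriv P Q).ennreal_toReal
  set g : (n : ℕ) → α → Fin (n * n + 1) := fun n x ↦ gridIndex n (f x)
  have hgm (n : ℕ) : Measurable (g n) := (measurable_gridIndex n).comp hfm
  set r : (n : ℕ) → Fin (n * n + 1) → ℝ :=
    fun n j ↦ (P.map (g n)).real {j} / (Q.map (g n)).real {j} with hr
  have hstep (n : ℕ) : InformationTheory.klDiv (P.map (g n)) (Q.map (g n)) =
      ∫⁻ x, ENNReal.ofReal (InformationTheory.klFun (r n (g n x))) ∂Q := by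
    rw [klDiv_fintype_of_ac (h.map (hgm n)), ← lintegral_fintype
      (f := fun j ↦ ENNReal.ofReal (InformationTheory.klFun (r n j))),
      lintegral_map (measurable_of_finite _) (hgm n)]
  have hlim : ∀ᵐ x ∂Q, Tendsto (fun n ↦ r n (g n x)) atTop (𝓝 (f x)) := by
    have hnull (n : ℕ) : ∀ᵐ x ∂Q, Q (g n ⁻¹' {g n x}) ≠ 0 := by
      have : ∀ᵐ j ∂(Q.map (g n)), (Q.map (g n)) {j} ≠ 0 := by
        rw [ae_iff_of_countable]
        exact fun _ ↦ id
      filter_upwards [ae_of_ae_map (hgm n).aemeasurable this] with x hx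
      rwa [Measure.map_apply (hgm n) (measurableSet_singleton _)] at hx
    filter_upwards [ae_all_iff.2 hnull] with x hx
    have hbd : ∀ᶠ n : ℕ in atTop, r n (g n x) ∈ Set.Icc (f x - 1 / n) (f x + 1 / n) := by
      obtain ⟨N, hN⟩ := exists_nat_gt (f x)
      filter_upwards [eventually_ge_atTop N] with n hn
      have hms : MeasurableSet (g n ⁻¹' {g n x}) := hgm n (measurableSet_singleton _)
      simp only [hr, measureReal_def, Measure.map_apply (hgm n) (measurableSet_singleton _)]
      refine measureReal_div_mem_Icc h hms (hx n) fun y hy ↦ ?_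
      exact mem_Icc_of_gridIndex_eq ENNReal.toReal_nonneg ENNReal.toReal_nonneg
        (hN.trans_le (by exact_mod_cast hn)) hy
    refine tendsto_of_tendsto_of_tendsto_of_le_of_le' (g := fun n : ℕ ↦ f x - 1 / n)
      (h := fun n : ℕ ↦ f x + 1 / n) ?_ ?_ (hbd.mono fun _ h ↦ h.1) (hbd.mono fun _ h ↦ h.2)
    · simpa using tendsto_const_nhds.sub (tendsto_one_div_atTop_nhds_zero_nat (𝕜 := ℝ))
    · simpa using tendsto_const_nhds.add (tendsto_one_div_atTop_nhds_zero_nat (𝕜 := ℝ))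
  change _ ≤ liminf (fun n ↦ InformationTheory.klDiv (P.map (g n)) (Q.map (g n))) atTop
  rw [funext hstep, InformationTheory.klDiv_eq_lintegral_klFun_of_ac h]
  calc
    _ = ∫⁻ x, liminf (fun n ↦ ENNReal.ofReal (InformationTheory.klFun (r n (g n x)))) atTop ∂Q := by
        refine lintegral_congr_ae ?_
        filter_upwards [hlim] with x hx
        exact (ENNReal.tendsto_ofReal
          ((InformationTheory.continuous_klFun.tendsto _).comp hx)).liminf_eq.symm
    _ ≤ _ := lintegral_liminf_le fun n ↦
        (measurable_of_finite
          (fun j ↦ ENNReal.ofReal (InformationTheory.klFun (r n j)))).comp (hgm n)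

lemma exists_measurable_eq_preimage {J : ℕ} {A : Fin J → Set α} (hA : ∀ j, MeasurableSet (A j))
    (hd : Pairwise (Function.onFun Disjoint A)) (hU : (⋃ j, A j) = Set.univ) :
    ∃ g : α → Fin J, Measurable g ∧ A = fun j ↦ g ⁻¹' {j} := by
  choose g hg using fun x ↦ Set.mem_iUnion.1 (hU ▸ Set.mem_univ x)
  have hAg : A = fun j ↦ g ⁻¹' {j} := by
    ext j x
    refine ⟨fun hx ↦ ?_, fun hx ↦ hx ▸ hg x⟩
    by_contra hne
    exact Set.disjoint_left.1 (hd hne) (hg x) hx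
  exact ⟨g, measurable_to_countable' fun j ↦ congrFun hAg j ▸ hA j, hAg⟩

end Auxiliary

/-- Gelfand–Yaglom–Perez variational characterization: the Kullback–Leibler
divergence equals the supremum, over all finite measurable partitions, of the
discrete divergence between the induced distributions. -/
theorem klDiv_eq_iSup_discreteKL
    {α : Type*} [MeasurableSpace α]
    (P Q : Measure α) [IsProbabilityMeasure P] [IsProbabilityMeasure Q] :
    klDiv P Q =
      ⨆ (J : ℕ) (A : Fin J → Set α)
        (_ : (∀ j, MeasurableSet (A j)) ∧ Pairwise (Function.onFun Disjoint A) ∧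
          (⋃ j, A j) = Set.univ),
        discreteKL P Q A := by
  rw [klDiv_eq_informationTheory_klDiv]
  refine le_antisymm ?_ (iSup_le fun J ↦ iSup_le fun A ↦ iSup_le fun ⟨hA, hd, hU⟩ ↦ ?_)
  · have hle {J : ℕ} {g : α → Fin J} (hg : Measurable g) :
        InformationTheory.klDiv (P.map g) (Q.map g) ≤
          ⨆ (J : ℕ) (A : Fin J → Set α)
            (_ : (∀ j, MeasurableSet (A j)) ∧ Pairwise (Function.onFun Disjoint A) ∧
              (⋃ j, A j) = Set.univ), discreteKL P Q A := by
      rw [← discreteKL_preimage P Q hg]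
      refine le_iSup_of_le J (le_iSup_of_le (fun j ↦ g ⁻¹' {j}) (le_iSup_of_le
        ⟨fun j ↦ hg (measurableSet_singleton j), fun i j hij ↦ ?_, ?_⟩ le_rfl))
      · exact Disjoint.preimage g (Set.disjoint_singleton.2 hij)
      · ext x; simp
    by_cases hac : P ≪ Q
    · refine (klDiv_le_liminf_map_gridIndex hac).trans ?_
      refine Filter.liminf_le_of_le (by isBoundedDefault) fun b hb ↦ ?_
      obtain ⟨n, hn⟩ := hb.exists
      exact hn.trans (hle ((measurable_gridIndex n).comp
        (Measure.measurable_rnDeriv P Q).ennreal_toReal))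
    · obtain ⟨s, hs, hQ, hP⟩ : ∃ s, MeasurableSet s ∧ Q s = 0 ∧ P s ≠ 0 := by
        by_contra! H
        exact hac (Measure.AbsolutelyContinuous.mk fun s hs hQ ↦ H s hs hQ)
      have hg : Measurable fun x ↦ if x ∈ s then (0 : Fin 2) else 1 :=
        Measurable.ite hs measurable_const measurable_const
      have hpre : (fun x ↦ if x ∈ s then (0 : Fin 2) else 1) ⁻¹' {0} = s := by
        ext x; simp
      refine le_top.trans ((InformationTheory.klDiv_of_not_ac fun h ↦ hP ?_).ge.trans (hle hg))
      have := @h {0}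
      rw [Measure.map_apply hg (measurableSet_singleton _),
        Measure.map_apply hg (measurableSet_singleton _), hpre] at this
      exact this hQ
  · obtain ⟨g, hg, rfl⟩ := exists_measurable_eq_preimage hA hd hU
    rw [discreteKL_preimage P Q hg]
    exact InformationTheory.klDiv_map_le P Q hg
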